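/- arXiv:1009.1100 — 2 statements merged into one kernel-verified Lean document; each statement's English description precedes it below -/
import Mathlib

section
/- For a bivariate standard Gaussian pair (X,Y) with correlation ρ, the correlation of signs equals (2/π)·arcsin(ρ), i.e. E[sign(X)·sign(Y)] = (2/π) arcsin ρ (Grothendieck/price identity). -/
open MeasureTheory ProbabilityTheory Real

def IsBivGaussian {Ω : Type*} [MeasurableSpace Ω] (P : Measure Ω)
    (X Y : Ω → ℝ) (ρ : ℝ) : Prop :=
  ∀ a b : ℝ, Measure.map (fun ω => a * X ω + b * Y ω) P =
    gaussianReal 0 (Real.toNNReal (a ^ 2 + 2 * a * b * ρ + b ^ 2))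

lemma measurable_realSign : Measurable Real.sign := by
  unfold Real.sign
  exact Measurable.ite measurableSet_Iio measurable_const
    (Measurable.ite measurableSet_Ioi measurable_const measurable_const)

lemma realSign_pos_mul {r : ℝ} (hr : 0 < r) (x : ℝ) : Real.sign (r * x) = Real.sign x := by
  rcases lt_trichotomy x 0 with hx | hx | hx
  · rw [Real.sign_of_neg hx, Real.sign_of_neg (mul_neg_of_pos_of_neg hr hx)]
  · simp [hx]
  · rw [Real.sign_of_pos hx, Real.sign_of_pos (mul_pos hr hx)]

lemma radial_integral : ∫ r in Set.Ioi (0 : ℝ), r * Real.exp (-(r ^ 2) / 2) = 1 := by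
  have h := integral_Ioi_of_hasDerivAt_of_nonneg' (a := 0) (l := 0)
    (g := fun r : ℝ => -Real.exp (-(r ^ 2) / 2)) (g' := fun r => r * Real.exp (-(r ^ 2) / 2))
    (fun x _ => by
      have := ((((hasDerivAt_id x).pow 2).neg.div_const 2).exp).neg
      convert! this using 1
      simp
      ring)
    (fun x hx => mul_nonneg (le_of_lt hx) (Real.exp_pos _).le)
    (by
      rw [← neg_zero]
      apply Filter.Tendsto.neg
      apply Real.tendsto_exp_atBot.comp
      apply Filter.Tendsto.atBot_div_const (by norm_num)
      exact Filter.tendsto_neg_atTop_atBot.comp (Filter.tendsto_pow_atTop (by norm_num)))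
  rw [h]; simp

lemma angular_integral {θ : ℝ} (h1 : -(π / 2) ≤ θ) (h2 : θ ≤ π / 2) :
    ∫ φ in Set.Ioo (-π) π, Real.sign (Real.cos φ) * Real.sign (Real.sin (θ + φ)) = 4 * θ := by
  have hpi := Real.pi_pos
  set g : ℝ → ℝ := fun φ => Real.sign (Real.cos φ) * Real.sign (Real.sin (θ + φ)) with hg
  have hper : Function.Periodic g π := by
    intro φ
    simp only [hg]
    rw [← add_assoc, Real.cos_add_pi, Real.sin_add_pi, Real.sign_neg, Real.sign_neg]
    ring
  have hm : Measurable g := by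
    exact (measurable_realSign.comp (by fun_prop)).mul (measurable_realSign.comp (by fun_prop))
  have hb : ∀ x, ‖g x‖ ≤ 1 := by
    intro x
    simp only [hg]
    rcases Real.sign_apply_eq (Real.cos x) with h | h | h <;>
    rcases Real.sign_apply_eq (Real.sin (θ + x)) with h' | h' | h' <;> rw [h, h'] <;> norm_num
  have hint : ∀ a b, IntervalIntegrable g volume a b := by
    intro a b
    apply (intervalIntegrable_const (c := (1 : ℝ))).mono_fun hm.aestronglyMeasurable
    exact Filter.Eventually.of_forall fun x => by simpa using hb x
  have key : ∫ φ in (-(π / 2))..(π / 2), g φ = 2 * θ := by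
    rw [← intervalIntegral.integral_add_adjacent_intervals (hint _ (-θ)) (hint _ _)]
    have e1 : ∫ φ in (-(π / 2))..(-θ), g φ = ∫ φ in (-(π / 2))..(-θ), (-1 : ℝ) := by
      apply intervalIntegral.integral_congr_Ioo_of_le (by linarith)
      intro x hx
      have c : 0 < Real.cos x := Real.cos_pos_of_mem_Ioo ⟨hx.1, by linarith [hx.2]⟩
      have s : Real.sin (θ + x) < 0 :=
        Real.sin_neg_of_neg_of_neg_pi_lt (by linarith [hx.2]) (by linarith [hx.1])
      simp only [hg, Real.sign_of_pos c, Real.sign_of_neg s, one_mul]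
    have e2 : ∫ φ in (-θ)..(π / 2), g φ = ∫ φ in (-θ)..(π / 2), (1 : ℝ) := by
      apply intervalIntegral.integral_congr_Ioo_of_le (by linarith)
      intro x hx
      have c : 0 < Real.cos x := Real.cos_pos_of_mem_Ioo ⟨by linarith [hx.1], hx.2⟩
      have s : 0 < Real.sin (θ + x) :=
        Real.sin_pos_of_pos_of_lt_pi (by linarith [hx.1]) (by linarith [hx.2])
      simp only [hg, Real.sign_of_pos c, Real.sign_of_pos s, one_mul]
    rw [e1, e2]
    simp only [intervalIntegral.integral_const, smul_eq_mul]
    ring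
  rw [← integral_Ioc_eq_integral_Ioo, ← intervalIntegral.integral_of_le (by linarith),
    ← intervalIntegral.integral_add_adjacent_intervals (hint _ 0) (hint _ _)]
  have k1 := hper.intervalIntegral_add_eq (-π) (-(π / 2))
  have k2 := hper.intervalIntegral_add_eq 0 (-(π / 2))
  rw [show -(π / 2) + π = π / 2 by ring, key] at k1 k2
  rw [neg_add_cancel] at k1
  rw [zero_add] at k2
  rw [k1, k2]; ring

lemma std_integral {θ : ℝ} (h1 : -(π / 2) ≤ θ) (h2 : θ ≤ π / 2) :
    ∫ p, Real.sign p.1 * Real.sign (Real.sin θ * p.1 + Real.cos θ * p.2)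
      ∂((gaussianReal 0 1).prod (gaussianReal 0 1)) = (2 / π) * θ := by
  rw [gaussianReal_of_var_ne_zero 0 one_ne_zero,
    prod_withDensity (measurable_gaussianPDF 0 1) (measurable_gaussianPDF 0 1),
    integral_withDensity_eq_integral_toReal_smul
      (f := fun z : ℝ × ℝ => gaussianPDF 0 1 z.1 * gaussianPDF 0 1 z.2)
      (((measurable_gaussianPDF 0 1).comp measurable_fst).mul
        ((measurable_gaussianPDF 0 1).comp measurable_snd))
      (Filter.Eventually.of_forall fun x => ENNReal.mul_lt_top gaussianPDF_lt_top gaussianPDF_lt_top),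
    ← Measure.volume_eq_prod, ← integral_comp_polarCoord_symm]
  have : ∀ p ∈ polarCoord.target, p.1 • ((gaussianPDF 0 1 (polarCoord.symm p).1 *
      gaussianPDF 0 1 (polarCoord.symm p).2).toReal •
      (Real.sign (polarCoord.symm p).1 *
        Real.sign (Real.sin θ * (polarCoord.symm p).1 + Real.cos θ * (polarCoord.symm p).2))) =
      (p.1 * Real.exp (-(p.1 ^ 2) / 2)) * ((2 * π)⁻¹ *
        (Real.sign (Real.cos p.2) * Real.sign (Real.sin (θ + p.2)))) := by
    rintro ⟨r, φ⟩ hp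
    have hr : 0 < r := hp.1
    simp only [polarCoord_symm_apply, ENNReal.toReal_mul, toReal_gaussianPDF, smul_eq_mul]
    rw [show Real.sin θ * (r * Real.cos φ) + Real.cos θ * (r * Real.sin φ)
      = r * Real.sin (θ + φ) by rw [Real.sin_add]; ring, realSign_pos_mul hr, realSign_pos_mul hr]
    simp only [gaussianPDFReal, NNReal.coe_one, mul_one, sub_zero]
    have e : Real.exp (-(r * Real.cos φ) ^ 2 / 2) * Real.exp (-(r * Real.sin φ) ^ 2 / 2)
        = Real.exp (-(r ^ 2) / 2) := by
      rw [← Real.exp_add]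
      congr 1
      linear_combination (-(r ^ 2) / 2) * Real.sin_sq_add_cos_sq φ
    have s : (√(2 * π))⁻¹ * (√(2 * π))⁻¹ = (2 * π)⁻¹ := by
      rw [← mul_inv, Real.mul_self_sqrt (by positivity)]
    rw [← e, ← s]; ring
  rw [setIntegral_congr_fun polarCoord.open_target.measurableSet this, polarCoord_target,
    Measure.volume_eq_prod,
    setIntegral_prod_mul (fun r : ℝ => r * Real.exp (-(r ^ 2) / 2))
      (fun φ : ℝ => (2 * π)⁻¹ * (Real.sign (Real.cos φ) * Real.sign (Real.sin (θ + φ)))),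
    radial_integral, integral_const_mul, angular_integral h1 h2]
  field_simp
  ring

lemma std_linear (c d : ℝ) :
    Measure.map (fun p : ℝ × ℝ => c * p.1 + d * p.2) ((gaussianReal 0 1).prod (gaussianReal 0 1))
      = gaussianReal 0 (Real.toNNReal (c ^ 2 + d ^ 2)) := by
  have hi := indepFun_prod (μ := gaussianReal 0 1) (ν := gaussianReal 0 1)
    (X := fun x : ℝ => c * x) (Y := fun x : ℝ => d * x) (by fun_prop) (by fun_prop)
  have a1 : Measure.map (fun p : ℝ × ℝ => c * p.1) ((gaussianReal 0 1).prod (gaussianReal 0 1)) =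
      gaussianReal (c * 0) (.mk (c ^ 2) (sq_nonneg _) * 1) := by
    rw [← gaussianReal_map_const_mul, ← Measure.fst_prod (μ := gaussianReal 0 1)
      (ν := gaussianReal 0 1), Measure.fst, Measure.map_map (by fun_prop) (by fun_prop),
      ← Measure.fst, Measure.fst_prod]
    rfl
  have a2 : Measure.map (fun p : ℝ × ℝ => d * p.2) ((gaussianReal 0 1).prod (gaussianReal 0 1)) =
      gaussianReal (d * 0) (.mk (d ^ 2) (sq_nonneg _) * 1) := by
    rw [← gaussianReal_map_const_mul, ← Measure.snd_prod (μ := gaussianReal 0 1)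
      (ν := gaussianReal 0 1), Measure.snd, Measure.map_map (by fun_prop) (by fun_prop),
      ← Measure.snd, Measure.snd_prod]
    rfl
  have := gaussianReal_add_gaussianReal_of_indepFun hi a1 a2
  refine this.trans ?_
  congr 1
  · simp
  · ext
    rw [Real.coe_toNNReal _ (by positivity)]
    simp

/-- For a bivariate standard Gaussian pair with correlation `ρ`, the correlation of
signs equals `(2/π)·arcsin ρ`. -/
theorem stmt_2 {Ω : Type*} [MeasurableSpace Ω] (P : Measure Ω) [IsProbabilityMeasure P]
    (X Y : Ω → ℝ) (hX : Measurable X) (hY : Measurable Y) (ρ : ℝ)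
    (hρ₁ : -1 ≤ ρ) (hρ₂ : ρ ≤ 1) (h : IsBivGaussian P X Y ρ) :
    ∫ ω, Real.sign (X ω) * Real.sign (Y ω) ∂P = (2 / π) * Real.arcsin ρ := by
  set θ := Real.arcsin ρ with hθ
  have hs : Real.sin θ = ρ := Real.sin_arcsin hρ₁ hρ₂
  have hT : Measurable (fun p : ℝ × ℝ => (p.1, Real.sin θ * p.1 + Real.cos θ * p.2)) := by fun_prop
  have hXY : Measurable (fun ω => (X ω, Y ω)) := hX.prodMk hY
  have : IsProbabilityMeasure (P.map (fun ω => (X ω, Y ω))) :=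
    Measure.isProbabilityMeasure_map hXY.aemeasurable
  have : IsProbabilityMeasure (((gaussianReal 0 1).prod (gaussianReal 0 1)).map
      (fun p : ℝ × ℝ => (p.1, Real.sin θ * p.1 + Real.cos θ * p.2))) :=
    Measure.isProbabilityMeasure_map hT.aemeasurable
  have hlaw : P.map (fun ω => (X ω, Y ω)) = ((gaussianReal 0 1).prod (gaussianReal 0 1)).map
      (fun p : ℝ × ℝ => (p.1, Real.sin θ * p.1 + Real.cos θ * p.2)) := by
    apply Measure.ext_of_charFunDual
    ext L
    rw [charFunDual_eq_charFun_map_one, charFunDual_eq_charFun_map_one]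
    congr 1
    have hL : ∀ x y : ℝ, L (x, y) = L (1, 0) * x + L (0, 1) * y := by
      intro x y
      have : ((x, y) : ℝ × ℝ) = x • (1, 0) + y • (0, 1) := by simp
      rw [this, map_add, map_smul, map_smul, smul_eq_mul, smul_eq_mul]
      ring
    rw [Measure.map_map L.continuous.measurable hXY, Measure.map_map L.continuous.measurable hT]
    have e1 : (L ∘ fun ω => (X ω, Y ω)) = fun ω => L (1, 0) * X ω + L (0, 1) * Y ω := by
      funext ω; exact hL _ _
    have e2 : (L ∘ fun p : ℝ × ℝ => (p.1, Real.sin θ * p.1 + Real.cos θ * p.2)) =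
        fun p => (L (1, 0) + L (0, 1) * Real.sin θ) * p.1 + (L (0, 1) * Real.cos θ) * p.2 := by
      funext p
      simp only [Function.comp]
      rw [hL]; ring
    rw [e1, e2, h, std_linear]
    congr 2
    rw [← hs]
    linear_combination (-(L (0, 1)) ^ 2) * Real.sin_sq_add_cos_sq θ
  have hf : Measurable (fun q : ℝ × ℝ => Real.sign q.1 * Real.sign q.2) :=
    (measurable_realSign.comp measurable_fst).mul (measurable_realSign.comp measurable_snd)
  have i1 := integral_map (μ := P) hXY.aemeasurable hf.aestronglyMeasurable
  have i2 := integral_map (μ := (gaussianReal 0 1).prod (gaussianReal 0 1))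
    hT.aemeasurable hf.aestronglyMeasurable
  rw [← std_integral (Real.neg_pi_div_two_le_arcsin ρ) (Real.arcsin_le_pi_div_two ρ)]
  exact i1.symm.trans ((congrArg (fun m => ∫ q, Real.sign q.1 * Real.sign q.2 ∂m) hlaw).trans i2)
end

section
/- The asymptotic upper tail dependence coefficient of a bivariate Student-t copula with ν degrees of freedom and correlation ρ ∈ (−1,1) is τ*_UU = 2 − 2·T_{ν+1}(√(ν+1)·√(1−ρ)/√(1+ρ)), where T_{ν+1} is the univariate Student-t cdf with ν+1 degrees of freedom; in particular τ*_UU > 0. -/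
open MeasureTheory Real Filter

noncomputable def studentDensity (ν x : ℝ) : ℝ :=
  Real.Gamma ((ν + 1) / 2) / (Real.sqrt (ν * π) * Real.Gamma (ν / 2)) *
    (1 + x ^ 2 / ν) ^ (-((ν + 1) / 2))

noncomputable def studentCdf (ν x : ℝ) : ℝ :=
  ∫ t in Set.Iic x, studentDensity ν t

noncomputable def studentDensity2 (ν ρ x₁ x₂ : ℝ) : ℝ :=
  Real.Gamma ((ν + 2) / 2) / (Real.Gamma (ν / 2) * ν * π * Real.sqrt (1 - ρ ^ 2)) *
    (1 + (x₁ ^ 2 - 2 * ρ * x₁ * x₂ + x₂ ^ 2) / (ν * (1 - ρ ^ 2))) ^ (-((ν + 2) / 2))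


lemma aux_lint (s : ℝ) (hs : 1/2 < s) :
    ∫⁻ x : ℝ, ENNReal.ofReal (Real.Gamma s * (1 + x^2) ^ (-s)) =
      ENNReal.ofReal (√π * Real.Gamma (s - 1/2)) := by
  have h1 : ∀ x : ℝ, ENNReal.ofReal (Real.Gamma s * (1 + x^2) ^ (-s)) =
      ∫⁻ t in Set.Ioi (0:ℝ), ENNReal.ofReal (t ^ (s - 1) * rexp (-((1 + x^2) * t))) := by
    intro x
    have hx : 0 < 1 + x^2 := by positivity
    have hi := Real.integral_rpow_mul_exp_neg_mul_Ioi (a := s) (r := 1 + x^2) (by linarith) hx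
    have hG : 0 < Real.Gamma s := Real.Gamma_pos_of_pos (by linarith)
    have hpos : 0 < (1 / (1 + x^2)) ^ s * Real.Gamma s := by positivity
    rw [← ofReal_integral_eq_lintegral_ofReal]
    · rw [hi, Real.rpow_neg hx.le, one_div, Real.inv_rpow hx.le, mul_comm]
    · by_contra hc
      rw [integral_undef hc] at hi
      linarith
    · filter_upwards [ae_restrict_mem measurableSet_Ioi] with t ht
      have : (0:ℝ) < t := ht
      simp only [Pi.zero_apply]; positivity
  simp_rw [h1]
  rw [lintegral_lintegral_swap]
  · have h2 : ∀ t ∈ Set.Ioi (0:ℝ), ∫⁻ x : ℝ, ENNReal.ofReal (t ^ (s - 1) * rexp (-((1 + x^2) * t)))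
        = ENNReal.ofReal (√π * (t ^ ((s - 1/2) - 1) * rexp (-(1 * t)))) := by
      intro t ht
      have ht : (0:ℝ) < t := ht
      have e : ∀ x : ℝ, t ^ (s - 1) * rexp (-((1 + x^2) * t))
          = (t ^ (s - 1) * rexp (-t)) * rexp (-t * x^2) := by
        intro x
        rw [mul_assoc, ← Real.exp_add]; congr 2; ring
      simp_rw [e]
      rw [← ofReal_integral_eq_lintegral_ofReal]
      · rw [integral_const_mul, integral_gaussian]
        congr 1
        have : t ^ ((s - 1/2) - 1) = t ^ (s - 1) * (√t)⁻¹ := by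
          rw [Real.sqrt_eq_rpow, ← Real.rpow_neg ht.le, ← Real.rpow_add ht]; congr 1; ring
        rw [this, Real.sqrt_div pi_pos.le]
        simp only [one_mul]; field_simp
      · exact (integrable_exp_neg_mul_sq ht).const_mul _
      · exact ae_of_all _ fun x => by simp only [Pi.zero_apply]; positivity
    rw [setLIntegral_congr_fun measurableSet_Ioi h2]
    have hi := Real.integral_rpow_mul_exp_neg_mul_Ioi (a := s - 1/2) (r := 1) (by linarith) one_pos
    have hG : 0 < Real.Gamma (s - 1/2) := Real.Gamma_pos_of_pos (by linarith)
    rw [← ofReal_integral_eq_lintegral_ofReal]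
    · rw [integral_const_mul, hi]; simp
    · refine Integrable.const_mul ?_ _
      by_contra hc
      rw [integral_undef hc] at hi
      simp at hi
      norm_num at hG
      linarith
    · filter_upwards [ae_restrict_mem measurableSet_Ioi] with t ht
      have : (0:ℝ) < t := ht
      simp only [Pi.zero_apply]; positivity
  · refine Measurable.aemeasurable ?_
    unfold Function.uncurry
    fun_prop

lemma aux_int (s : ℝ) (hs : 1/2 < s) :
    ∫ x : ℝ, (1 + x^2) ^ (-s) = √π * Real.Gamma (s - 1/2) / Real.Gamma s := by
  have hG : 0 < Real.Gamma s := Real.Gamma_pos_of_pos (by linarith)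
  have hG' : 0 < Real.Gamma (s - 1/2) := Real.Gamma_pos_of_pos (by linarith)
  have h : ∫ x : ℝ, Real.Gamma s * (1 + x^2) ^ (-s) = √π * Real.Gamma (s - 1/2) := by
    rw [integral_eq_lintegral_of_nonneg_ae, aux_lint s hs, ENNReal.toReal_ofReal]
    · positivity
    · exact ae_of_all _ fun x => by simp only [Pi.zero_apply]; positivity
    · exact Measurable.aestronglyMeasurable (by fun_prop)
  rw [integral_const_mul] at h
  rw [← h]; field_simp

lemma sd_pos (ν x : ℝ) (hν : 0 < ν) : 0 < studentDensity ν x := by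
  have := Real.Gamma_pos_of_pos (show 0 < (ν + 1) / 2 by linarith)
  have := Real.Gamma_pos_of_pos (show 0 < ν / 2 by linarith)
  have := pi_pos
  unfold studentDensity
  positivity

lemma sd_total (ν : ℝ) (hν : 0 < ν) : ∫ x, studentDensity ν x = 1 := by
  have h1 := Real.Gamma_pos_of_pos (show 0 < (ν + 1) / 2 by linarith)
  have h2 := Real.Gamma_pos_of_pos (show 0 < ν / 2 by linarith)
  have h3 := pi_pos
  unfold studentDensity
  rw [integral_const_mul]
  have e : ∀ x : ℝ, (1 + x ^ 2 / ν) ^ (-((ν + 1) / 2)) =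
      (fun z : ℝ => (1 + z ^ 2) ^ (-((ν + 1) / 2))) (x / √ν) := by
    intro x
    simp only [div_pow, Real.sq_sqrt hν.le]
  rw [integral_congr_ae (ae_of_all _ e),
    Measure.integral_comp_div (fun z : ℝ => (1 + z ^ 2) ^ (-((ν + 1) / 2))),
    aux_int _ (by linarith)]
  have : (ν + 1) / 2 - 1 / 2 = ν / 2 := by ring
  rw [this, abs_of_nonneg (Real.sqrt_nonneg _), Real.sqrt_mul hν.le, smul_eq_mul]
  have := Real.sqrt_pos.2 hν
  have := Real.sqrt_pos.2 h3
  field_simp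

lemma sd_integrable (ν : ℝ) (hν : 0 < ν) : Integrable (studentDensity ν) :=
  .of_integral_ne_zero (by rw [sd_total ν hν]; norm_num)

lemma sd_tail (ν x : ℝ) (hν : 0 < ν) :
    ∫ t in Set.Ioi x, studentDensity ν t = 1 - studentCdf ν x := by
  have := intervalIntegral.integral_Iic_add_Ioi (sd_integrable ν hν).integrableOn
    (sd_integrable ν hν).integrableOn (b := x)
  rw [sd_total ν hν] at this
  unfold studentCdf
  linarith

lemma sd_tail_pos (ν x : ℝ) (hν : 0 < ν) :
    0 < ∫ t in Set.Ioi x, studentDensity ν t := by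
  rw [setIntegral_pos_iff_support_of_nonneg_ae
    (ae_of_all _ fun t => (sd_pos ν t hν).le) (sd_integrable ν hν).integrableOn]
  have : Function.support (studentDensity ν) = Set.univ := by
    ext t; simp [(sd_pos ν t hν).ne']
  rw [this]; simp

lemma sd_cdf_cont (ν : ℝ) (hν : 0 < ν) : Continuous (studentCdf ν) := by
  have h : studentCdf ν = fun x => studentCdf ν 0 + ∫ t in (0:ℝ)..x, studentDensity ν t := by
    ext x
    have := intervalIntegral.integral_Iic_sub_Iic (a := 0) (b := x)
      (sd_integrable ν hν).integrableOn (sd_integrable ν hν).integrableOn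
    unfold studentCdf
    linarith
  rw [h]
  exact continuous_const.add
    (intervalIntegral.continuous_primitive (fun a b => (sd_integrable ν hν).intervalIntegrable) 0)

lemma sd_cdf_mono (ν : ℝ) (hν : 0 < ν) : Monotone (studentCdf ν) := by
  intro a b hab
  exact setIntegral_mono_set (sd_integrable ν hν).integrableOn
    (ae_of_all _ fun t => (sd_pos ν t hν).le) (Set.Iic_subset_Iic.2 hab).eventuallyLE

lemma Q_tendsto (ν : ℝ) (hν : 0 < ν) 
    (Q : ℝ → ℝ) (hQ : ∀ p ∈ Set.Ioo (0 : ℝ) 1, studentCdf ν (Q p) = p) :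
    Tendsto Q (nhdsWithin 1 (Set.Iio 1)) atTop := by
  rw [tendsto_atTop]
  intro M
  have hM : studentCdf ν M < 1 := by
    have := sd_tail_pos ν M hν
    rw [sd_tail ν M hν] at this; linarith
  filter_upwards [Ioo_mem_nhdsLT (max_lt hM one_pos)] with p hp
  obtain ⟨h1, h2⟩ := hp
  rw [max_lt_iff] at h1
  by_contra! hc
  have := sd_cdf_mono ν hν hc.le
  rw [hQ p ⟨h1.2, h2⟩] at this
  linarith

/-- conditional scale -/
noncomputable def condScale (ν ρ x : ℝ) : ℝ := √((1 - ρ^2) * (ν + x^2) / (ν + 1))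

lemma condScale_pos (ν ρ x : ℝ) (hν : 0 < ν) (hr : 0 < 1 - ρ^2) : 0 < condScale ν ρ x := by
  unfold condScale; positivity

lemma sd2_factor (ν ρ x y : ℝ) (hν : 0 < ν) (hr : 0 < 1 - ρ^2) :
    studentDensity2 ν ρ x y = studentDensity ν x *
      ((condScale ν ρ x)⁻¹ * studentDensity (ν + 1) ((y - ρ * x) / condScale ν ρ x)) := by
  have h1 := Real.Gamma_pos_of_pos (show 0 < (ν + 1) / 2 by linarith)
  have h2 := Real.Gamma_pos_of_pos (show 0 < ν / 2 by linarith)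
  have h3 := pi_pos
  have hs : (condScale ν ρ x)^2 = (1 - ρ^2) * (ν + x^2) / (ν + 1) :=
    Real.sq_sqrt (by positivity)
  have hA : 0 < 1 + x^2 / ν := by positivity
  set B := 1 + ((y - ρ * x) / condScale ν ρ x)^2 / (ν + 1) with hB
  have hBpos : 0 < B := by positivity
  have hAB : 1 + (x ^ 2 - 2 * ρ * x * y + y ^ 2) / (ν * (1 - ρ ^ 2)) = (1 + x^2 / ν) * B := by
    rw [hB, div_pow, hs]
    have : 0 < ν + x^2 := by positivity
    field_simp
    ring
  have hinv : (condScale ν ρ x)⁻¹ = √(ν + 1) / (√(1 - ρ^2) * √ν) * (1 + x^2/ν)^(-(1/2 : ℝ)) := by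
    have e : (1 - ρ^2) * (ν + x^2) / (ν + 1) = (1 - ρ^2) * ν * (1 + x^2/ν) / (ν + 1) := by
      field_simp
    unfold condScale
    rw [e, Real.sqrt_div (by positivity), Real.sqrt_mul (by positivity), Real.sqrt_mul (by positivity),
      Real.rpow_neg hA.le, ← Real.sqrt_eq_rpow]
    have := Real.sqrt_pos.2 hA
    field_simp
  have hAp : (1 + x^2/ν) ^ (-((ν + 2)/2)) =
      (1 + x^2/ν) ^ (-((ν + 1)/2)) * (1 + x^2/ν)^(-(1/2 : ℝ)) := by
    rw [← Real.rpow_add hA]; congr 1; ring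
  unfold studentDensity2 studentDensity
  rw [← hB, hAB, Real.mul_rpow hA.le hBpos.le, hinv, hAp, show ν + 1 + 1 = ν + 2 by ring,
    Real.sqrt_mul (by positivity), Real.sqrt_mul (by positivity)]
  have a1 := Real.sqrt_pos.2 hν
  have a2 := Real.sqrt_pos.2 (show 0 < ν + 1 by linarith)
  have a3 := Real.sqrt_pos.2 hr
  have a4 := Real.sq_sqrt h3.le
  have a5 := Real.sq_sqrt hν.le
  have a6 := Real.sqrt_pos.2 h3
  generalize (1 + x^2/ν) ^ (-((ν + 1)/2)) = p1
  generalize (1 + x^2/ν)^(-(1/2 : ℝ)) = p2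
  generalize B ^ (-((ν + 2)/2)) = p3
  have : Real.Gamma ((ν + 2) / 2) / (Real.Gamma (ν / 2) * ν * π * √(1 - ρ ^ 2)) =
     Real.Gamma ((ν + 2) / 2) / (Real.Gamma (ν / 2) * √ν^2 * √π^2 * √(1 - ρ ^ 2)) := by rw [a4, a5]
  rw [this]
  field_simp

lemma sd2_nonneg (ν ρ x y : ℝ) (hν : 0 < ν) (hr : 0 < 1 - ρ^2) : 0 ≤ studentDensity2 ν ρ x y := by
  rw [sd2_factor ν ρ x y hν hr]
  have := sd_pos ν x hν
  have := condScale_pos ν ρ x hν hr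
  have := sd_pos (ν + 1) ((y - ρ * x) / condScale ν ρ x) (by linarith)
  positivity

lemma sd2_integrable_snd (ν ρ x : ℝ) (hν : 0 < ν) (hr : 0 < 1 - ρ^2) :
    Integrable (studentDensity2 ν ρ x) := by
  have : studentDensity2 ν ρ x = fun y => studentDensity ν x *
      ((condScale ν ρ x)⁻¹ * studentDensity (ν + 1) ((y - ρ * x) / condScale ν ρ x)) := by
    ext y; exact sd2_factor ν ρ x y hν hr
  rw [this]
  refine Integrable.const_mul (Integrable.const_mul ?_ _) _
  exact ((sd_integrable (ν + 1) (by linarith)).comp_div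
    (condScale_pos ν ρ x hν hr).ne').comp_sub_right (ρ * x)

lemma sd2_total_snd (ν ρ x : ℝ) (hν : 0 < ν) (hr : 0 < 1 - ρ^2) :
    ∫ y, studentDensity2 ν ρ x y = studentDensity ν x := by
  have hs := condScale_pos ν ρ x hν hr
  simp_rw [sd2_factor ν ρ x _ hν hr]
  rw [integral_const_mul, integral_const_mul,
    integral_sub_right_eq_self (fun y => studentDensity (ν + 1) (y / condScale ν ρ x)),
    Measure.integral_comp_div, sd_total _ (by linarith), abs_of_pos hs, smul_eq_mul]
  field_simp

lemma sd2_tail_snd (ν ρ x a : ℝ) (hν : 0 < ν) (hr : 0 < 1 - ρ^2) :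
    ∫ y in Set.Ioi a, studentDensity2 ν ρ x y =
      studentDensity ν x * (1 - studentCdf (ν + 1) ((a - ρ * x) / condScale ν ρ x)) := by
  have hs := condScale_pos ν ρ x hν hr
  simp_rw [sd2_factor ν ρ x _ hν hr]
  rw [integral_const_mul, integral_const_mul, ← sd_tail _ _ (by linarith)]
  congr 1
  rw [← integral_indicator measurableSet_Ioi, ← integral_indicator measurableSet_Ioi]
  have e : (Set.Ioi a).indicator (fun y => studentDensity (ν + 1) ((y - ρ * x) / condScale ν ρ x))
      = fun y => (fun w => ((Set.Ioi ((a - ρ * x) / condScale ν ρ x)).indicator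
        (studentDensity (ν + 1))) (w / condScale ν ρ x)) (y - ρ * x) := by
    ext y
    simp only [Set.indicator, Set.mem_Ioi]
    simp only [div_lt_div_iff_of_pos_right hs, sub_lt_sub_iff_right]
  rw [e, integral_sub_right_eq_self (fun w => ((Set.Ioi ((a - ρ * x) / condScale ν ρ x)).indicator
        (studentDensity (ν + 1))) (w / condScale ν ρ x)), Measure.integral_comp_div,
    abs_of_pos hs, smul_eq_mul]
  field_simp

lemma sd2_integrable (ν ρ : ℝ) (hν : 0 < ν) (hr : 0 < 1 - ρ^2) :
    Integrable (Function.uncurry (studentDensity2 ν ρ)) (volume.prod volume) := by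
  rw [integrable_prod_iff]
  · refine ⟨ae_of_all _ fun x => sd2_integrable_snd ν ρ x hν hr, ?_⟩
    have : (fun x => ∫ y, ‖Function.uncurry (studentDensity2 ν ρ) (x, y)‖) = studentDensity ν := by
      ext x
      simp only [Function.uncurry_apply_pair]
      simp_rw [Real.norm_of_nonneg (sd2_nonneg ν ρ x _ hν hr)]
      exact sd2_total_snd ν ρ x hν hr
    rw [this]
    exact sd_integrable ν hν
  · refine Measurable.aestronglyMeasurable ?_
    unfold Function.uncurry studentDensity2
    fun_prop

lemma sd2_symm (ν ρ x y : ℝ) : studentDensity2 ν ρ x y = studentDensity2 ν ρ y x := by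
  unfold studentDensity2
  congr 4; ring

lemma split_symm (F : ℝ → ℝ → ℝ) (hs : ∀ x y, F x y = F y x)
    (hF : Integrable (Function.uncurry F) (volume.prod volume)) (q : ℝ) :
    ∫ x in Set.Ioi q, ∫ y in Set.Ioi q, F x y =
      2 * ∫ x in Set.Ioi q, ∫ y in Set.Ioi x, F x y := by
  set μ := (volume : Measure ℝ).restrict (Set.Ioi q) with hμ
  have hF' : Integrable (Function.uncurry F) (μ.prod μ) := by
    rw [hμ, Measure.prod_restrict]; exact hF.restrict
  have mA : MeasurableSet {p : ℝ × ℝ | p.1 < p.2} := measurableSet_lt measurable_fst measurable_snd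
  have i1 := hF'.indicator mA
  have i2 := hF'.indicator mA.compl
  have t1 : ∫ p, Set.indicator {p : ℝ × ℝ | p.1 < p.2} (Function.uncurry F) p ∂(μ.prod μ) =
      ∫ x in Set.Ioi q, ∫ y in Set.Ioi x, F x y := by
    rw [integral_prod _ i1]
    refine setIntegral_congr_fun measurableSet_Ioi fun x hx => ?_
    have e : (fun y => Set.indicator {p : ℝ × ℝ | p.1 < p.2} (Function.uncurry F) (x, y)) =
        (Set.Ioi x).indicator (F x) := by
      ext y; simp [Set.indicator]
    simp only [e]
    rw [integral_indicator measurableSet_Ioi, hμ, Measure.restrict_restrict measurableSet_Ioi,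
      Set.inter_eq_left.2 (Set.Ioi_subset_Ioi (le_of_lt hx))]
  have t2 : ∫ p, Set.indicator {p : ℝ × ℝ | p.1 < p.2}ᶜ (Function.uncurry F) p ∂(μ.prod μ) =
      ∫ x in Set.Ioi q, ∫ y in Set.Ioi x, F x y := by
    rw [integral_prod_symm _ i2]
    refine setIntegral_congr_fun measurableSet_Ioi fun x hx => ?_
    have e : (fun y => Set.indicator {p : ℝ × ℝ | p.1 < p.2}ᶜ (Function.uncurry F) (y, x)) =
        (Set.Ici x).indicator (F x) := by
      ext y; simp [Set.indicator, hs y x]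
    simp only [e]
    rw [integral_indicator measurableSet_Ici, hμ, Measure.restrict_restrict measurableSet_Ici,
      Set.inter_eq_left.2 (Set.Ici_subset_Ioi.2 hx), integral_Ici_eq_integral_Ioi]
  rw [two_mul]
  nth_rewrite 1 [← t1]
  rw [← t2, ← integral_add i1 i2, integral_integral hF']
  congr 1
  ext p
  rw [← Pi.add_apply, Set.indicator_self_add_compl]
  rfl

lemma avg_limit (f G : ℝ → ℝ) (L : ℝ) (hf : Integrable f) (hf0 : ∀ x, 0 < f x)
    (hfp : ∀ q, 0 < ∫ x in Set.Ioi q, f x)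
    (hfG : Integrable (fun x => f x * G x)) (hG : Tendsto G atTop (nhds L)) :
    Tendsto (fun q => (∫ x in Set.Ioi q, f x * G x) / ∫ x in Set.Ioi q, f x) atTop (nhds L) := by
  rw [Metric.tendsto_atTop] at hG ⊢
  intro ε hε
  obtain ⟨N, hN⟩ := hG (ε / 2) (by linarith)
  refine ⟨N, fun q hq => ?_⟩
  have hD := hfp q
  have e : (∫ x in Set.Ioi q, f x * G x) / (∫ x in Set.Ioi q, f x) - L =
      (∫ x in Set.Ioi q, (f x * G x - f x * L)) / (∫ x in Set.Ioi q, f x) := by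
    rw [integral_sub hfG.restrict (hf.mul_const L).restrict, integral_mul_const]
    field_simp
  rw [Real.dist_eq, e, abs_div, abs_of_pos hD, div_lt_iff₀ hD]
  calc |∫ x in Set.Ioi q, (f x * G x - f x * L)|
      ≤ ∫ x in Set.Ioi q, f x * (ε / 2) := by
        rw [← Real.norm_eq_abs]
        refine norm_integral_le_of_norm_le (hf.mul_const _).restrict ?_
        filter_upwards [ae_restrict_mem measurableSet_Ioi] with x hx
        have := hN x (hq.le.trans (le_of_lt hx))
        rw [Real.dist_eq] at this
        rw [← mul_sub, norm_mul, Real.norm_of_nonneg (hf0 x).le, Real.norm_eq_abs]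
        exact mul_le_mul_of_nonneg_left this.le (hf0 x).le
    _ = (∫ x in Set.Ioi q, f x) * (ε / 2) := integral_mul_const _ _
    _ < ε * ∫ x in Set.Ioi q, f x := by nlinarith

lemma arg_limit (ν ρ : ℝ) (hν : 0 < ν) (hρ₁ : -1 < ρ) (hρ₂ : ρ < 1) :
    Tendsto (fun x => (x - ρ * x) / condScale ν ρ x) atTop
      (nhds (√(ν + 1) * √(1 - ρ) / √(1 + ρ))) := by
  have h1 : 0 < 1 - ρ := by linarith
  have h2 : 0 < 1 + ρ := by linarith
  have hlim : Tendsto (fun x : ℝ => √(ν + 1) * √(1 - ρ) / √(1 + ρ) / √(ν * (x⁻¹)^2 + 1)) atTop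
      (nhds (√(ν + 1) * √(1 - ρ) / √(1 + ρ) / √(ν * 0^2 + 1))) := by
    refine Tendsto.div tendsto_const_nhds ?_ (by simp)
    exact ((((tendsto_inv_atTop_zero).pow 2).const_mul ν).add_const 1).sqrt
  simp only [ne_eq, OfNat.ofNat_ne_zero, not_false_eq_true, zero_pow, mul_zero, zero_add,
    Real.sqrt_one, div_one] at hlim
  refine hlim.congr' ?_
  filter_upwards [eventually_gt_atTop 0] with x hx
  have e : (1 - ρ^2) * (ν + x^2) / (ν + 1) = (1 - ρ) * (1 + ρ) * (x^2 * (ν * (x⁻¹)^2 + 1)) / (ν + 1) := by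
    field_simp; ring
  unfold condScale
  have h3 : 0 < ν * (x⁻¹)^2 + 1 := by positivity
  rw [e, Real.sqrt_div (by positivity), Real.sqrt_mul (by positivity), Real.sqrt_mul (by positivity),
    Real.sqrt_mul (by positivity), Real.sqrt_sq hx.le]
  have a1 := Real.sqrt_pos.2 h1
  have a2 := Real.sqrt_pos.2 h2
  have a3 := Real.sqrt_pos.2 h3
  have a4 : x - ρ * x = √(1 - ρ) ^ 2 * x := by rw [Real.sq_sqrt h1.le]; ring
  rw [a4]
  generalize √(ν * (x⁻¹)^2 + 1) = z at *
  field_simp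

/-- The asymptotic upper tail dependence coefficient of the bivariate Student-t copula:
`lim_{p→1⁻} P[X₁ > T_ν⁻¹(p) | X₂ > T_ν⁻¹(p)] = 2 - 2·T_{ν+1}(√(ν+1)√(1-ρ)/√(1+ρ)) > 0`.
Here `Q` is the quantile function `T_ν⁻¹`. -/
theorem stmt_15 (ν ρ : ℝ) (hν : 0 < ν) (hρ₁ : -1 < ρ) (hρ₂ : ρ < 1)
    (Q : ℝ → ℝ) (hQ : ∀ p ∈ Set.Ioo (0 : ℝ) 1, studentCdf ν (Q p) = p) :
    Tendsto (fun p =>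
        (∫ x in Set.Ioi (Q p), ∫ y in Set.Ioi (Q p), studentDensity2 ν ρ x y) /
          (∫ x in Set.Ioi (Q p), studentDensity ν x))
      (nhdsWithin 1 (Set.Iio 1))
      (nhds (2 - 2 * studentCdf (ν + 1)
        (Real.sqrt (ν + 1) * Real.sqrt (1 - ρ) / Real.sqrt (1 + ρ)))) ∧
    0 < 2 - 2 * studentCdf (ν + 1)
        (Real.sqrt (ν + 1) * Real.sqrt (1 - ρ) / Real.sqrt (1 + ρ)) := by
  have hr : 0 < 1 - ρ ^ 2 := by nlinarith
  have hν1 : 0 < ν + 1 := by linarith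
  set b := Real.sqrt (ν + 1) * Real.sqrt (1 - ρ) / Real.sqrt (1 + ρ) with hb
  constructor
  · have key : ∀ q, ∫ x in Set.Ioi q, ∫ y in Set.Ioi q, studentDensity2 ν ρ x y =
        ∫ x in Set.Ioi q, studentDensity ν x *
          (2 - 2 * studentCdf (ν + 1) ((x - ρ * x) / condScale ν ρ x)) := by
      intro q
      rw [split_symm _ (sd2_symm ν ρ) (sd2_integrable ν ρ hν hr), ← integral_const_mul]
      congr 1
      ext x
      rw [sd2_tail_snd ν ρ x x hν hr]; ring
    simp_rw [key]
    have hcont := sd_cdf_cont (ν + 1) hν1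
    have hG : Tendsto (fun x => 2 - 2 * studentCdf (ν + 1) ((x - ρ * x) / condScale ν ρ x)) atTop
        (nhds (2 - 2 * studentCdf (ν + 1) b)) :=
      ((hcont.tendsto b).comp (arg_limit ν ρ hν hρ₁ hρ₂)).const_mul 2 |>.const_sub 2
    refine (avg_limit (studentDensity ν) _ _ (sd_integrable ν hν) (fun x => sd_pos ν x hν)
      (fun q => sd_tail_pos ν q hν) ?_ hG).comp (Q_tendsto ν hν Q hQ)
    refine (sd_integrable ν hν).mul_bdd (c := 2) ?_ (ae_of_all _ fun x => ?_)
    · refine Measurable.aestronglyMeasurable ?_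
      have : Measurable fun x => (x - ρ * x) / condScale ν ρ x := by
        unfold condScale; fun_prop
      exact ((hcont.measurable.comp this).const_mul 2).const_sub 2
    · have h1 := sd_tail_pos (ν + 1) ((x - ρ * x) / condScale ν ρ x) hν1
      rw [sd_tail _ _ hν1] at h1
      have h2 : 0 ≤ studentCdf (ν + 1) ((x - ρ * x) / condScale ν ρ x) :=
        integral_nonneg fun t => (sd_pos _ t hν1).le
      rw [Real.norm_eq_abs, abs_le]
      constructor <;> linarith
  · have := sd_tail_pos (ν + 1) b hν1
    rw [sd_tail _ _ hν1] at this
    linarith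
end
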